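/- Let μ be a probability measure on a product of finite sets satisfying the 𝔡-log-Sobolev inequality Ent_μ(f²) ≤ 2σ² ∫|𝔡f|² dμ, where |𝔡f|²(x) = Σᵢ Var_{μ(·|x_{i^c})}(f(x_{i^c},·)). Then for any f ∈ L^∞(μ) and any r ≥ 2, ‖f − E f‖_{L^r(μ)} ≤ (σ²(r − 3/2)/2)^{1/2}·‖|𝔥f|‖_{L^r(μ)}, where 𝔥ᵢf(x) = sup_{y,y' ∈ 𝒳ᵢ supported by μ(·|x_{i^c})} |f(x_{i^c},y) − f(x_{i^c},y')| and |𝔥f| is the Euclidean norm of (𝔥₁f,…,𝔥ₙf). -/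

import Mathlib

open MeasureTheory

/-- The tangent line at `c` lies below `x ↦ x ^ e` when `1 ≤ e`. -/
lemma rpow_tangent_le {b c e : ℝ} (hb : 0 ≤ b) (hc : 0 < c) (he : 1 ≤ e) :
    c ^ e + e * c ^ (e - 1) * (b - c) ≤ b ^ e := by
  have h := one_add_mul_self_le_rpow_one_add (s := b / c - 1)
    (by linarith [div_nonneg hb hc.le]) he
  rw [add_sub_cancel, Real.div_rpow hb hc.le, le_div_iff₀ (by positivity)] at h
  rw [Real.rpow_sub_one hc.ne']
  refine le_of_eq_of_le ?_ h
  field_simp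

/-- The tangent line at `c` lies above `x ↦ x ^ q` when `0 ≤ q ≤ 1`. -/
lemma rpow_le_tangent {b c q : ℝ} (hb : 0 ≤ b) (hc : 0 < c) (hq : 0 ≤ q) (hq1 : q ≤ 1) :
    b ^ q ≤ c ^ q + q * c ^ (q - 1) * (b - c) := by
  have h := rpow_one_add_le_one_add_mul_self (s := b / c - 1)
    (by linarith [div_nonneg hb hc.le]) hq hq1
  rw [add_sub_cancel, Real.div_rpow hb hc.le, div_le_iff₀ (by positivity)] at h
  rw [Real.rpow_sub_one hc.ne']
  refine h.trans_eq ?_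
  field_simp

/-- Midpoint bound for the increments of `x ↦ x ^ p`, `1 ≤ p ≤ 2`. -/
lemma rpow_sub_rpow_le_midpoint {m M p : ℝ} (hm : 0 ≤ m) (hmM : m ≤ M) (hp : 1 ≤ p)
    (hp2 : p ≤ 2) :
    M ^ p - m ^ p ≤ p * (M - m) * ((M + m) / 2) ^ (p - 1) := by
  have key : MonotoneOn (fun x : ℝ => p * (x - m) * ((x + m) / 2) ^ (p - 1) - x ^ p)
      (Set.Ici m) := by
    have hd : ∀ x ∈ Set.Ioi m,
        HasDerivAt (fun x : ℝ => p * (x - m) * ((x + m) / 2) ^ (p - 1) - x ^ p)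
          (p * ((x + m) / 2) ^ (p - 1)
            + p * (x - m) * (1 / 2 * (p - 1) * ((x + m) / 2) ^ (p - 1 - 1))
            - p * x ^ (p - 1)) x := by
      intro x hx
      have hx0 : 0 < x := hm.trans_lt hx
      have h1 : HasDerivAt (fun x : ℝ => p * (x - m)) p x := by
        simpa using ((hasDerivAt_id x).sub_const m).const_mul p
      have h2 : HasDerivAt (fun x : ℝ => (x + m) / 2) (1 / 2) x := by
        simpa using ((hasDerivAt_id x).add_const m).div_const 2
      have h3 := h2.rpow_const (p := p - 1) (Or.inl (by positivity))
      exact (h1.mul h3).sub (Real.hasDerivAt_rpow_const (Or.inl hx0.ne'))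
    apply monotoneOn_of_deriv_nonneg (convex_Ici m)
    · apply ContinuousOn.sub
      · apply ContinuousOn.mul (by fun_prop)
        exact ContinuousOn.rpow_const (by fun_prop) fun x _ => Or.inr (by linarith)
      · exact ContinuousOn.rpow_const (by fun_prop) fun x _ => Or.inr (by linarith)
    · rw [interior_Ici]
      exact fun x hx => (hd x hx).differentiableAt.differentiableWithinAt
    · rw [interior_Ici]
      intro x hx
      rw [(hd x hx).deriv]
      have hx' : m < x := hx
      have ht := rpow_le_tangent (b := x) (c := (x + m) / 2) (q := p - 1)
        (by linarith) (by linarith) (by linarith) (by linarith)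
      nlinarith [mul_le_mul_of_nonneg_left ht (by linarith : 0 ≤ p)]
  have h := key (Set.mem_Ici.2 le_rfl) (Set.mem_Ici.2 hmM) hmM
  simp only [sub_self, mul_zero, zero_mul] at h
  linarith

/-- Trapezoid bound for the increments of `x ↦ x ^ k`, `2 ≤ k`. -/
lemma rpow_sub_rpow_le_trapezoid {a b k : ℝ} (hb : 0 ≤ b) (hba : b ≤ a) (hk : 2 ≤ k) :
    a ^ k - b ^ k ≤ k * (a - b) * ((a ^ (k - 1) + b ^ (k - 1)) / 2) := by
  have key : MonotoneOn (fun x : ℝ => k * (x - b) * ((x ^ (k - 1) + b ^ (k - 1)) / 2) - x ^ k)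
      (Set.Ici b) := by
    have hd : ∀ x ∈ Set.Ioi b,
        HasDerivAt (fun x : ℝ => k * (x - b) * ((x ^ (k - 1) + b ^ (k - 1)) / 2) - x ^ k)
          (k * ((x ^ (k - 1) + b ^ (k - 1)) / 2)
            + k * (x - b) * ((k - 1) * x ^ (k - 1 - 1) / 2) - k * x ^ (k - 1)) x := by
      intro x hx
      have hx0 : 0 < x := hb.trans_lt hx
      have h1 : HasDerivAt (fun x : ℝ => k * (x - b)) k x := by
        simpa using ((hasDerivAt_id x).sub_const b).const_mul k
      have h2 := ((Real.hasDerivAt_rpow_const (p := k - 1) (Or.inl hx0.ne')).add_const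
        (b ^ (k - 1))).div_const 2
      exact (h1.mul h2).sub (Real.hasDerivAt_rpow_const (Or.inl hx0.ne'))
    apply monotoneOn_of_deriv_nonneg (convex_Ici b)
    · apply ContinuousOn.sub
      · apply ContinuousOn.mul (by fun_prop)
        apply ContinuousOn.div_const
        apply ContinuousOn.add _ continuousOn_const
        exact ContinuousOn.rpow_const (by fun_prop) fun x _ => Or.inr (by linarith)
      · exact ContinuousOn.rpow_const (by fun_prop) fun x _ => Or.inr (by linarith)
    · rw [interior_Ici]
      exact fun x hx => (hd x hx).differentiableAt.differentiableWithinAt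
    · rw [interior_Ici]
      intro x hx
      rw [(hd x hx).deriv]
      have hx' : b < x := hx
      have ht := rpow_tangent_le (b := b) (c := x) (e := k - 1) hb (by linarith) (by linarith)
      nlinarith [mul_le_mul_of_nonneg_left ht (by linarith : 0 ≤ k)]
  have h := key (Set.mem_Ici.2 le_rfl) (Set.mem_Ici.2 hba) hba
  simp only [sub_self, mul_zero, zero_mul] at h
  linarith

/-- Cauchy-Schwarz bound for the increments of `x ↦ x ^ p`, `1 ≤ p`. -/
lemma sq_rpow_sub_rpow_le {a b p : ℝ} (hb : 0 ≤ b) (hba : b ≤ a) (hp : 1 ≤ p) :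
    (2 * p - 1) * (a ^ p - b ^ p) ^ 2 ≤
      p ^ 2 * (a - b) * (a ^ (2 * p - 1) - b ^ (2 * p - 1)) := by
  have key : ∀ l : ℝ, MonotoneOn
      (fun x : ℝ => p ^ 2 * x ^ (2 * p - 1) - (2 * p - 1) * (2 * l * x ^ p) +
        (2 * p - 1) * (l ^ 2 * x)) (Set.Ici b) := by
    intro l
    have hd : ∀ x ∈ Set.Ioi b, HasDerivAt
        (fun x : ℝ => p ^ 2 * x ^ (2 * p - 1) - (2 * p - 1) * (2 * l * x ^ p) +
          (2 * p - 1) * (l ^ 2 * x))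
          (p ^ 2 * ((2 * p - 1) * x ^ (2 * p - 1 - 1)) -
            (2 * p - 1) * (2 * l * (p * x ^ (p - 1))) + (2 * p - 1) * (l ^ 2 * 1)) x := by
      intro x hx
      have hx0 : 0 < x := hb.trans_lt hx
      exact (((Real.hasDerivAt_rpow_const (Or.inl hx0.ne')).const_mul _).sub
        (((Real.hasDerivAt_rpow_const (Or.inl hx0.ne')).const_mul _).const_mul _)).add
        (((hasDerivAt_id x).const_mul _).const_mul _)
    apply monotoneOn_of_deriv_nonneg (convex_Ici b)
    · have h1 : ContinuousOn (fun x : ℝ => x ^ (2 * p - 1)) (Set.Ici b) :=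
        ContinuousOn.rpow_const (by fun_prop) fun x _ => Or.inr (by linarith)
      have h2 : ContinuousOn (fun x : ℝ => x ^ p) (Set.Ici b) :=
        ContinuousOn.rpow_const (by fun_prop) fun x _ => Or.inr (by linarith)
      fun_prop
    · rw [interior_Ici]
      exact fun x hx => (hd x hx).differentiableAt.differentiableWithinAt
    · rw [interior_Ici]
      intro x hx
      rw [(hd x hx).deriv]
      have hx0 : 0 < x := hb.trans_lt hx
      have e : x ^ (2 * p - 1 - 1) = (x ^ (p - 1)) ^ 2 := by
        rw [← Real.rpow_natCast, ← Real.rpow_mul hx0.le]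
        congr 1
        push_cast
        ring
      rw [e]
      nlinarith [mul_nonneg (by linarith : 0 ≤ 2 * p - 1) (sq_nonneg (p * x ^ (p - 1) - l))]
  rcases hba.eq_or_lt with rfl | hlt
  · simp
  have hab : 0 < a - b := by linarith
  have h := key ((a ^ p - b ^ p) / (a - b)) (Set.mem_Ici.2 le_rfl) (Set.mem_Ici.2 hba) hba
  simp only at h
  set A := a ^ p
  set B := b ^ p
  set l := (A - B) / (a - b) with hl
  have hl' : l * (a - b) = A - B := by rw [hl]; field_simp
  have h' : (2 * p - 1) * (l * (A - B)) ≤ p ^ 2 * (a ^ (2 * p - 1) - b ^ (2 * p - 1)) := by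
    have h2 : l ^ 2 * (a - b) = l * (A - B) := by rw [← hl']; ring
    linear_combination h + (2 * p - 1) * h2
  calc (2 * p - 1) * (A - B) ^ 2 = (2 * p - 1) * (l * (A - B)) * (a - b) := by
        rw [← hl']; ring
    _ ≤ _ := (mul_le_mul_of_nonneg_right h' hab.le).trans_eq (by ring)

/-- Symmetric bound for the increments of `x ↦ x ^ (r / 2)`, `3 ≤ r`. -/
lemma sq_rpow_sub_rpow_le_average {a b r : ℝ} (ha : 0 ≤ a) (hb : 0 ≤ b) (hr : 3 ≤ r) :
    (a ^ (r / 2) - b ^ (r / 2)) ^ 2 ≤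
      r ^ 2 / 8 * (a - b) ^ 2 * (a ^ (r - 2) + b ^ (r - 2)) := by
  wlog hba : b ≤ a generalizing a b
  · have := this hb ha (by linarith)
    linarith
  have h1 := sq_rpow_sub_rpow_le (p := r / 2) hb hba (by linarith)
  have h2 := rpow_sub_rpow_le_trapezoid (k := r - 1) hb hba (by linarith)
  rw [show 2 * (r / 2) - 1 = r - 1 by ring] at h1
  rw [show r - 1 - 1 = r - 2 by ring] at h2
  have h3 := mul_le_mul_of_nonneg_left h2
    (mul_nonneg (sq_nonneg (r / 2)) (by linarith : 0 ≤ a - b))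
  have h4 : (r - 1) * (a ^ (r / 2) - b ^ (r / 2)) ^ 2 ≤
      (r - 1) * (r ^ 2 / 8 * (a - b) ^ 2 * (a ^ (r - 2) + b ^ (r - 2))) := by
    calc _ ≤ _ := h1
      _ ≤ _ := h3
      _ = _ := by ring
  exact le_of_mul_le_mul_left h4 (by linarith)

section Weighted

variable {α : Type*} [Fintype α] {c : α → ℝ}

lemma sum_mul_sq_sub_mean (hc1 : ∑ y, c y = 1) (U : α → ℝ) :
    ∑ y, c y * (U y - ∑ z, c z * U z) ^ 2 = ∑ y, c y * U y ^ 2 - (∑ z, c z * U z) ^ 2 := by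
  set m := ∑ z, c z * U z with hm
  calc ∑ y, c y * (U y - m) ^ 2
      = ∑ y, (c y * U y ^ 2 - 2 * m * (c y * U y) + m ^ 2 * c y) :=
        Finset.sum_congr rfl fun y _ => by ring
    _ = ∑ y, c y * U y ^ 2 - 2 * m * m + m ^ 2 * 1 := by
        rw [Finset.sum_add_distrib, Finset.sum_sub_distrib, ← Finset.mul_sum, ← Finset.mul_sum,
          ← hm, hc1]
    _ = _ := by ring

lemma sum_mul_sq_sub_mean_le (hc1 : ∑ y, c y = 1) (U : α → ℝ) (t : ℝ) :
    ∑ y, c y * (U y - ∑ z, c z * U z) ^ 2 ≤ ∑ y, c y * (U y - t) ^ 2 := by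
  rw [sum_mul_sq_sub_mean hc1]
  have : ∑ y, c y * (U y - t) ^ 2 =
      ∑ y, c y * U y ^ 2 - 2 * t * (∑ z, c z * U z) + t ^ 2 * 1 := by
    rw [← hc1, Finset.mul_sum, Finset.mul_sum, ← Finset.sum_sub_distrib,
      ← Finset.sum_add_distrib]
    exact Finset.sum_congr rfl fun y _ => by ring
  rw [this]
  nlinarith [sq_nonneg (∑ z, c z * U z - t)]

lemma two_mul_sum_mul_sq_sub_mean (hc1 : ∑ y, c y = 1) (U : α → ℝ) :
    2 * ∑ y, c y * (U y - ∑ z, c z * U z) ^ 2 =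
      ∑ y, ∑ z, c y * c z * (U y - U z) ^ 2 := by
  rw [sum_mul_sq_sub_mean hc1]
  set m := ∑ z, c z * U z with hm
  set q := ∑ z, c z * U z ^ 2 with hq
  have h : ∀ y, ∑ z, c y * c z * (U y - U z) ^ 2 =
      c y * U y ^ 2 - 2 * m * (c y * U y) + q * c y := by
    intro y
    calc ∑ z, c y * c z * (U y - U z) ^ 2
        = ∑ z, (c y * U y ^ 2 * c z - 2 * (c y * U y) * (c z * U z) + c y * (c z * U z ^ 2)) :=
          Finset.sum_congr rfl fun z _ => by ring
      _ = _ := by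
          rw [Finset.sum_add_distrib, Finset.sum_sub_distrib, ← Finset.mul_sum, ← Finset.mul_sum,
            ← Finset.mul_sum, ← hm, ← hq, hc1]
          ring
  rw [Finset.sum_congr rfl fun y _ => h y, Finset.sum_add_distrib, Finset.sum_sub_distrib,
    ← Finset.mul_sum, ← Finset.mul_sum, ← hm, ← hq, hc1]
  ring

/-- Popoviciu's inequality for a weighted finite family. -/
lemma sum_mul_sq_sub_mean_le_of_mem_Icc (hc : ∀ y, 0 ≤ c y) (hc1 : ∑ y, c y = 1) {U : α → ℝ}
    {A B : ℝ} (hU : ∀ y, 0 < c y → A ≤ U y ∧ U y ≤ B) :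
    ∑ y, c y * (U y - ∑ z, c z * U z) ^ 2 ≤ (B - A) ^ 2 / 4 := by
  calc _ ≤ ∑ y, c y * (U y - (A + B) / 2) ^ 2 := sum_mul_sq_sub_mean_le hc1 U _
    _ ≤ ∑ y, c y * ((B - A) ^ 2 / 4) := by
        refine Finset.sum_le_sum fun y _ => ?_
        rcases (hc y).eq_or_lt with h | h
        · simp [← h]
        · refine mul_le_mul_of_nonneg_left ?_ h.le
          nlinarith [hU y h]
    _ = _ := by rw [← Finset.sum_mul, hc1, one_mul]

lemma exists_min_max_of_weights (hc : ∀ y, 0 ≤ c y) (hc1 : ∑ y, c y = 1) (u : α → ℝ) :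
    ∃ y₀ y₁, 0 < c y₀ ∧ 0 < c y₁ ∧ ∀ y, 0 < c y → u y₀ ≤ u y ∧ u y ≤ u y₁ := by
  classical
  have hne : (Finset.univ.filter fun y => 0 < c y).Nonempty := by
    by_contra h
    rw [Finset.not_nonempty_iff_eq_empty, Finset.filter_eq_empty_iff] at h
    have : ∑ y, c y = 0 := Finset.sum_eq_zero fun y hy => le_antisymm (not_lt.1 (h hy)) (hc y)
    linarith
  obtain ⟨y₀, h₀, hmin⟩ := Finset.exists_min_image _ u hne
  obtain ⟨y₁, h₁, hmax⟩ := Finset.exists_max_image _ u hne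
  simp only [Finset.mem_filter, Finset.mem_univ, true_and] at h₀ h₁ hmin hmax
  exact ⟨y₀, y₁, h₀, h₁, fun y hy => ⟨hmin y hy, hmax y hy⟩⟩

lemma sum_mul_sq_sub_mean_le_of_osc (hc : ∀ y, 0 ≤ c y) (hc1 : ∑ y, c y = 1) {u : α → ℝ} {h : ℝ}
    (hosc : ∀ y z, 0 < c y → 0 < c z → |u y - u z| ≤ h) :
    ∑ y, c y * (u y - ∑ z, c z * u z) ^ 2 ≤ h ^ 2 / 4 := by
  obtain ⟨y₀, y₁, h₀, h₁, hb⟩ := exists_min_max_of_weights hc hc1 u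
  refine (sum_mul_sq_sub_mean_le_of_mem_Icc hc hc1 hb).trans ?_
  have := abs_le.1 (hosc y₁ y₀ h₁ h₀)
  have := (hb y₀ h₀).2
  nlinarith

/-- Variance of `u ^ (r / 2)` in terms of the oscillation of `u`, for `3 ≤ r`. -/
lemma variance_rpow_le_of_three_le (hc : ∀ y, 0 ≤ c y) (hc1 : ∑ y, c y = 1) {u : α → ℝ}
    (hu : ∀ y, 0 ≤ u y) {h : ℝ} (hosc : ∀ y z, 0 < c y → 0 < c z → |u y - u z| ≤ h)
    {r : ℝ} (hr : 3 ≤ r) :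
    ∑ y, c y * (u y ^ (r / 2) - ∑ z, c z * u z ^ (r / 2)) ^ 2 ≤
      r ^ 2 / 8 * (h ^ 2 * ∑ y, c y * u y ^ (r - 2)) := by
  have key : ∑ y, ∑ z, c y * c z * (u y ^ (r / 2) - u z ^ (r / 2)) ^ 2 ≤
      ∑ y, ∑ z, (r ^ 2 / 8 * h ^ 2 * (c y * u y ^ (r - 2)) * c z +
        r ^ 2 / 8 * h ^ 2 * c y * (c z * u z ^ (r - 2))) := by
    refine Finset.sum_le_sum fun y _ => Finset.sum_le_sum fun z _ => ?_
    rcases (hc y).eq_or_lt with hy | hy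
    · simp [← hy]
    rcases (hc z).eq_or_lt with hz | hz
    · simp [← hz]
    have h1 := sq_rpow_sub_rpow_le_average (hu y) (hu z) hr
    have h2 : (u y - u z) ^ 2 ≤ h ^ 2 := sq_le_sq' (abs_le.1 (hosc y z hy hz)).1
      (abs_le.1 (hosc y z hy hz)).2
    have h3 : 0 ≤ u y ^ (r - 2) + u z ^ (r - 2) :=
      add_nonneg (Real.rpow_nonneg (hu y) _) (Real.rpow_nonneg (hu z) _)
    calc _ ≤ c y * c z * (r ^ 2 / 8 * h ^ 2 * (u y ^ (r - 2) + u z ^ (r - 2))) := by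
          gcongr
          refine h1.trans ?_
          gcongr
      _ = _ := by ring
  rw [← two_mul_sum_mul_sq_sub_mean hc1 fun y => u y ^ (r / 2)] at key
  have e : ∑ y, ∑ z, (r ^ 2 / 8 * h ^ 2 * (c y * u y ^ (r - 2)) * c z +
        r ^ 2 / 8 * h ^ 2 * c y * (c z * u z ^ (r - 2))) =
      2 * (r ^ 2 / 8 * (h ^ 2 * ∑ y, c y * u y ^ (r - 2))) := by
    simp_rw [Finset.sum_add_distrib, ← Finset.mul_sum, ← Finset.sum_mul, ← Finset.mul_sum, hc1]
    ring
  linarith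

/-- Variance of `u ^ (r / 2)` in terms of the oscillation of `u`, for `2 ≤ r ≤ 3`. -/
lemma variance_rpow_le_of_le_three (hc : ∀ y, 0 ≤ c y) (hc1 : ∑ y, c y = 1) {u : α → ℝ}
    (hu : ∀ y, 0 ≤ u y) {h : ℝ} (hosc : ∀ y z, 0 < c y → 0 < c z → |u y - u z| ≤ h)
    {r : ℝ} (hr : 2 ≤ r) (hr3 : r ≤ 3) :
    ∑ y, c y * (u y ^ (r / 2) - ∑ z, c z * u z ^ (r / 2)) ^ 2 ≤
      r ^ 2 / 16 * (h ^ 2 * ∑ y, c y * u y ^ (r - 2) + h ^ 2 * (h / 2) ^ (r - 2)) := by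
  obtain ⟨y₀, y₁, h₀, h₁, hb⟩ := exists_min_max_of_weights hc hc1 u
  have hmono : ∀ y, 0 < c y →
      u y₀ ^ (r / 2) ≤ u y ^ (r / 2) ∧ u y ^ (r / 2) ≤ u y₁ ^ (r / 2) := fun y hy =>
    ⟨Real.rpow_le_rpow (hu _) (hb y hy).1 (by linarith),
      Real.rpow_le_rpow (hu _) (hb y hy).2 (by linarith)⟩
  refine (sum_mul_sq_sub_mean_le_of_mem_Icc hc hc1 hmono).trans ?_
  have hle : u y₀ ≤ u y₁ := (hb y₀ h₀).2
  have hd : u y₁ - u y₀ ≤ h := (le_abs_self _).trans (hosc y₁ y₀ h₁ h₀)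
  have hh : 0 ≤ h := by linarith
  have hm := hu y₀
  have hM := hu y₁
  have hmid := rpow_sub_rpow_le_midpoint (p := r / 2) hm hle (by linarith) (by linarith)
  have hsq : (((u y₁ + u y₀) / 2) ^ (r / 2 - 1)) ^ 2 ≤
      u y₀ ^ (r - 2) + (h / 2) ^ (r - 2) := by
    rw [← Real.rpow_natCast, ← Real.rpow_mul (by positivity)]
    calc ((u y₁ + u y₀) / 2) ^ ((r / 2 - 1) * ((2 : ℕ) : ℝ))
        = ((u y₁ + u y₀) / 2) ^ (r - 2) := by congr 1; push_cast; ring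
      _ ≤ (u y₀ + h / 2) ^ (r - 2) :=
          Real.rpow_le_rpow (by positivity) (by linarith) (by linarith)
      _ ≤ _ := Real.rpow_add_le_add_rpow hm (by positivity) (by linarith) (by linarith)
  have hmean : u y₀ ^ (r - 2) ≤ ∑ y, c y * u y ^ (r - 2) := by
    calc u y₀ ^ (r - 2) = ∑ y, c y * u y₀ ^ (r - 2) := by rw [← Finset.sum_mul, hc1, one_mul]
      _ ≤ _ := by
          refine Finset.sum_le_sum fun y _ => ?_
          rcases (hc y).eq_or_lt with hy | hy
          · simp [← hy]
          · exact mul_le_mul_of_nonneg_left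
              (Real.rpow_le_rpow hm (hb y hy).1 (by linarith)) hy.le
  have hnn : 0 ≤ u y₁ ^ (r / 2) - u y₀ ^ (r / 2) := sub_nonneg.2 (hmono y₀ h₀).2
  calc (u y₁ ^ (r / 2) - u y₀ ^ (r / 2)) ^ 2 / 4
      ≤ (r / 2 * (u y₁ - u y₀) * ((u y₁ + u y₀) / 2) ^ (r / 2 - 1)) ^ 2 / 4 := by gcongr
    _ = r ^ 2 / 16 * ((u y₁ - u y₀) ^ 2 * (((u y₁ + u y₀) / 2) ^ (r / 2 - 1)) ^ 2) := by ring
    _ ≤ r ^ 2 / 16 * (h ^ 2 * (∑ y, c y * u y ^ (r - 2) + (h / 2) ^ (r - 2))) := by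
        have h5 : (u y₁ - u y₀) ^ 2 ≤ h ^ 2 := by
          have : 0 ≤ u y₁ - u y₀ := by linarith
          gcongr
        gcongr
        linarith
    _ = _ := by ring

end Weighted

/-- A finite probability space with weights `w` together with, for each index `i`, a resampling
kernel which moves `x` to `move i x y` with probability `cond i x y` and preserves `w`. -/
structure ResamplingSystem (Ω ι : Type*) (Y : ι → Type*) [Fintype Ω] [Fintype ι]
    [∀ i, Fintype (Y i)] where
  w : Ω → ℝ
  cond : ∀ i, Ω → Y i → ℝ
  move : ∀ i, Ω → Y i → Ω
  w_nonneg : ∀ x, 0 ≤ w x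
  w_sum : ∑ x, w x = 1
  cond_nonneg : ∀ i x y, 0 ≤ cond i x y
  cond_sum : ∀ i x, 0 < w x → ∑ y, cond i x y = 1
  invariant : ∀ i (φ : Ω → ℝ), ∑ x, w x * ∑ y, cond i x y * φ (move i x y) = ∑ x, w x * φ x

namespace ResamplingSystem

variable {Ω ι : Type*} {Y : ι → Type*} [Fintype Ω] [Fintype ι] [∀ i, Fintype (Y i)]
  (S : ResamplingSystem Ω ι Y)

/-- Variance of `f` under the `i`-th resampling kernel. -/
noncomputable def condVar (i : ι) (f : Ω → ℝ) (x : Ω) : ℝ :=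
  ∑ y, S.cond i x y * (f (S.move i x y) - ∑ z, S.cond i x z * f (S.move i x z)) ^ 2

/-- The expected sum of the conditional variances. -/
noncomputable def energy (f : Ω → ℝ) : ℝ := ∑ x, S.w x * ∑ i, S.condVar i f x

/-- The logarithmic Sobolev inequality with constant `C`. -/
def LogSobolev (C : ℝ) : Prop := ∀ f : Ω → ℝ,
  ∑ x, S.w x * (f x ^ 2 * Real.log (f x ^ 2)) -
    (∑ x, S.w x * f x ^ 2) * Real.log (∑ x, S.w x * f x ^ 2) ≤ 2 * C * S.energy f

/-- `h i` bounds the oscillation of `f` along the `i`-th resampling and is unchanged by it. -/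
structure IsOscBound (f : Ω → ℝ) (h : ι → Ω → ℝ) : Prop where
  osc : ∀ i x y z, 0 < S.cond i x y → 0 < S.cond i x z →
    |f (S.move i x y) - f (S.move i x z)| ≤ h i x
  move_eq : ∀ i x y, h i (S.move i x y) = h i x

variable {S}

lemma sum_le_sum_of_pos {F G : Ω → ℝ} (hFG : ∀ x, 0 < S.w x → F x ≤ G x) :
    ∑ x, S.w x * F x ≤ ∑ x, S.w x * G x := by
  refine Finset.sum_le_sum fun x _ => ?_
  rcases (S.w_nonneg x).eq_or_lt with h | h
  · simp [← h]
  · exact mul_le_mul_of_nonneg_left (hFG x h) h.le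

lemma sum_eq_sum_of_pos {F G : Ω → ℝ} (hFG : ∀ x, 0 < S.w x → F x = G x) :
    ∑ x, S.w x * F x = ∑ x, S.w x * G x :=
  le_antisymm (sum_le_sum_of_pos fun x hx => (hFG x hx).le)
    (sum_le_sum_of_pos fun x hx => (hFG x hx).ge)

lemma energy_one_add_mul (g : Ω → ℝ) (t : ℝ) :
    S.energy (fun x => 1 + t * g x) = t ^ 2 * S.energy g := by
  unfold energy
  rw [Finset.mul_sum]
  simp_rw [mul_left_comm (t ^ 2)]
  refine sum_eq_sum_of_pos fun x hx => ?_
  rw [Finset.mul_sum]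
  refine Finset.sum_congr rfl fun i _ => ?_
  unfold condVar
  have hmean : ∑ z, S.cond i x z * (1 + t * g (S.move i x z)) =
      1 + t * ∑ z, S.cond i x z * g (S.move i x z) := by
    simp_rw [mul_add, mul_one, mul_left_comm _ t]
    rw [Finset.sum_add_distrib, S.cond_sum i x hx, Finset.mul_sum]
  rw [hmean]
  refine Eq.symm ?_
  rw [Finset.mul_sum]
  exact Finset.sum_congr rfl fun y _ => by ring

lemma sum_condVar_le (i : ι) (f : Ω → ℝ) :
    ∑ x, S.w x * S.condVar i f x ≤ ∑ x, S.w x * f x ^ 2 - (∑ x, S.w x * f x) ^ 2 := by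
  have h : ∑ x, S.w x * S.condVar i f x = ∑ x, S.w x *
      ((∑ y, S.cond i x y * f (S.move i x y) ^ 2) -
        (∑ y, S.cond i x y * f (S.move i x y)) ^ 2) :=
    sum_eq_sum_of_pos fun x hx => sum_mul_sq_sub_mean (S.cond_sum i x hx) _
  have hJ := sum_mul_sq_sub_mean S.w_sum fun x => ∑ y, S.cond i x y * f (S.move i x y)
  have hn : 0 ≤ ∑ x, S.w x * ((∑ y, S.cond i x y * f (S.move i x y)) -
      ∑ z, S.w z * ∑ y, S.cond i z y * f (S.move i z y)) ^ 2 :=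
    Finset.sum_nonneg fun x _ => mul_nonneg (S.w_nonneg x) (sq_nonneg _)
  rw [hJ, S.invariant i f] at hn
  rw [h]
  simp_rw [mul_sub]
  rw [Finset.sum_sub_distrib, S.invariant i fun x => f x ^ 2]
  linarith

end ResamplingSystem

/-- Third order expansion of `(1 + z) ^ 2 * log ((1 + z) ^ 2)` at `0`, as a lower bound. -/
lemma le_sq_mul_log_sq {z : ℝ} (hz : |z| ≤ 1 / 2) :
    2 * z + 3 * z ^ 2 - 10 * |z| ^ 3 ≤ (1 + z) ^ 2 * Real.log ((1 + z) ^ 2) := by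
  have h := Real.abs_log_sub_add_sum_range_le (x := -z) (by rw [abs_neg]; linarith) 2
  rw [abs_neg] at h
  norm_num [Finset.sum_range_succ] at h
  have h2 : |z| ^ 3 / (1 - |z|) ≤ 2 * |z| ^ 3 := by
    rw [div_le_iff₀ (by linarith)]
    nlinarith [pow_nonneg (abs_nonneg z) 3]
  have hlog : z - z ^ 2 / 2 - 2 * |z| ^ 3 ≤ Real.log (1 + z) := by
    have := (abs_le.1 (h.trans h2)).1
    linarith
  rw [Real.log_pow]
  push_cast
  have h3 : z ^ 4 ≤ 1 / 2 * |z| ^ 3 := by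
    have : z ^ 4 = |z| * |z| ^ 3 := by
      rw [← pow_succ', ← abs_pow, abs_of_nonneg (Even.pow_nonneg ⟨2, rfl⟩ z)]
    rw [this]
    gcongr
  have h4 : (1 + z) ^ 2 ≤ 9 / 4 := by
    have := abs_le.1 hz
    nlinarith
  have h5 := mul_le_mul_of_nonneg_left hlog (sq_nonneg (1 + z))
  have h6 := mul_le_mul_of_nonneg_right h4 (pow_nonneg (abs_nonneg z) 3)
  nlinarith

namespace ResamplingSystem

variable {Ω ι : Type*} {Y : ι → Type*} [Fintype Ω] [Fintype ι] [∀ i, Fintype (Y i)]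
  {S : ResamplingSystem Ω ι Y} {C : ℝ}

/-- The logarithmic Sobolev inequality implies the Poincaré inequality. -/
lemma LogSobolev.poincare_of_mean_zero (hS : S.LogSobolev C) {g : Ω → ℝ}
    (hg : ∑ x, S.w x * g x = 0) : ∑ x, S.w x * g x ^ 2 ≤ C * S.energy g := by
  set V := ∑ x, S.w x * g x ^ 2 with hV
  set T := ∑ x, S.w x * |g x| ^ 3 with hT
  obtain ⟨M, hM0, hM⟩ : ∃ M : ℝ, 0 < M ∧ ∀ x, |g x| ≤ M := by
    refine ⟨1 + ∑ x, |g x|, by positivity, fun x => ?_⟩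
    have := Finset.single_le_sum (f := fun x => |g x|) (fun x _ => abs_nonneg _)
      (Finset.mem_univ x)
    linarith
  have hV0 : 0 ≤ V := Finset.sum_nonneg fun x _ => mul_nonneg (S.w_nonneg x) (sq_nonneg _)
  have key : ∀ t : ℝ, 0 < t → t < 1 / (2 * M) →
      2 * V - 10 * t * T - t ^ 2 * V ^ 2 ≤ 2 * C * S.energy g := by
    intro t ht htM
    have hsm : ∀ x, |t * g x| ≤ 1 / 2 := by
      intro x
      rw [abs_mul, abs_of_pos ht]
      calc t * |g x| ≤ 1 / (2 * M) * M := by gcongr; exact hM x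
        _ = 1 / 2 := by field_simp
    have h := hS fun x => 1 + t * g x
    rw [energy_one_add_mul] at h
    have hm : ∑ x, S.w x * (1 + t * g x) ^ 2 = 1 + t ^ 2 * V := by
      calc _ = ∑ x, (S.w x + 2 * t * (S.w x * g x) + t ^ 2 * (S.w x * g x ^ 2)) :=
            Finset.sum_congr rfl fun x _ => by ring
        _ = _ := by
            rw [Finset.sum_add_distrib, Finset.sum_add_distrib, ← Finset.mul_sum,
              ← Finset.mul_sum, hg, S.w_sum]
            ring
    have hlow : 3 * t ^ 2 * V - 10 * t ^ 3 * T ≤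
        ∑ x, S.w x * ((1 + t * g x) ^ 2 * Real.log ((1 + t * g x) ^ 2)) := by
      calc 3 * t ^ 2 * V - 10 * t ^ 3 * T
          = ∑ x, (2 * t * (S.w x * g x) + 3 * t ^ 2 * (S.w x * g x ^ 2) -
              10 * t ^ 3 * (S.w x * |g x| ^ 3)) := by
            rw [Finset.sum_sub_distrib, Finset.sum_add_distrib, ← Finset.mul_sum,
              ← Finset.mul_sum, ← Finset.mul_sum, hg]
            ring
        _ ≤ _ := by
            refine Finset.sum_le_sum fun x _ => ?_
            refine le_trans (le_of_eq ?_)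
              (mul_le_mul_of_nonneg_left (le_sq_mul_log_sq (hsm x)) (S.w_nonneg x))
            rw [abs_mul, abs_of_pos ht]
            ring
    rw [hm] at h
    have hlog : (1 + t ^ 2 * V) * Real.log (1 + t ^ 2 * V) ≤
        (1 + t ^ 2 * V) * (t ^ 2 * V) := by
      have hpos : 0 < 1 + t ^ 2 * V := by positivity
      have := Real.log_le_sub_one_of_pos hpos
      gcongr
      linarith
    have hfin : t ^ 2 * (2 * V - 10 * t * T - t ^ 2 * V ^ 2) ≤ t ^ 2 * (2 * C * S.energy g) := by
      linarith
    exact le_of_mul_le_mul_left hfin (by positivity)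
  have hlim : Filter.Tendsto (fun t : ℝ => 2 * V - 10 * t * T - t ^ 2 * V ^ 2)
      (nhdsWithin 0 (Set.Ioi 0)) (nhds (2 * V)) := by
    have : Continuous fun t : ℝ => 2 * V - 10 * t * T - t ^ 2 * V ^ 2 := by fun_prop
    simpa using (this.tendsto 0).mono_left nhdsWithin_le_nhds
  have hle := le_of_tendsto hlim (by
    filter_upwards [Ioo_mem_nhdsGT (show (0 : ℝ) < 1 / (2 * M) by positivity)] with t ht
    exact key t ht.1 ht.2)
  linarith

lemma LogSobolev.poincare (hS : S.LogSobolev C) (f : Ω → ℝ) :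
    ∑ x, S.w x * f x ^ 2 - (∑ x, S.w x * f x) ^ 2 ≤ C * S.energy f := by
  set m := ∑ x, S.w x * f x with hm
  have h0 : ∑ x, S.w x * (f x - m) = 0 := by
    simp_rw [mul_sub]
    rw [Finset.sum_sub_distrib, ← Finset.sum_mul, S.w_sum, ← hm]
    ring
  have h := hS.poincare_of_mean_zero h0
  rw [sum_mul_sq_sub_mean S.w_sum] at h
  refine h.trans_eq ?_
  congr 1
  refine sum_eq_sum_of_pos fun x hx => Finset.sum_congr rfl fun i _ => ?_
  unfold condVar
  have hmean : ∑ z, S.cond i x z * (f (S.move i x z) - m) =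
      ∑ z, S.cond i x z * f (S.move i x z) - m := by
    simp_rw [mul_sub]
    rw [Finset.sum_sub_distrib, ← Finset.sum_mul, S.cond_sum i x hx, one_mul]
  rw [hmean]
  exact Finset.sum_congr rfl fun y _ => by ring

/-- If some function which varies only under the `j`-th resampling is not constant, then the
logarithmic Sobolev constant is at least `1`. -/
lemma LogSobolev.one_le (hS : S.LogSobolev C) {f : Ω → ℝ} {j : ι}
    (hf : ∀ i, i ≠ j → ∀ x y, f (S.move i x y) = f x)
    (hvar : 0 < ∑ x, S.w x * f x ^ 2 - (∑ x, S.w x * f x) ^ 2) : 1 ≤ C := by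
  have he : S.energy f = ∑ x, S.w x * S.condVar j f x := by
    refine sum_eq_sum_of_pos fun x hx => Finset.sum_eq_single j (fun i _ hij => ?_) (by simp)
    unfold condVar
    simp_rw [hf i hij]
    rw [← Finset.sum_mul, S.cond_sum i x hx]
    simp [← Finset.sum_mul, S.cond_sum i x hx]
  have h1 := hS.poincare f
  have h2 := S.sum_condVar_le j f
  rw [he] at h1
  have h0 : 0 ≤ ∑ x, S.w x * S.condVar j f x :=
    Finset.sum_nonneg fun x _ => mul_nonneg (S.w_nonneg x)
      (Finset.sum_nonneg fun y _ => mul_nonneg (S.cond_nonneg j x y) (sq_nonneg _))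
  by_contra! hC
  rcases h0.eq_or_lt with h | h
  · rw [← h, mul_zero] at h1
    linarith
  · nlinarith [mul_pos (sub_pos.2 hC) h]

end ResamplingSystem

section Moments

variable {Ω : Type*} [Fintype Ω] {w u v : Ω → ℝ} {r s : ℝ}

lemma sq_mul_rpow_sub_two {a : ℝ} (ha : 0 ≤ a) (hs : 2 ≤ s) : a ^ 2 * a ^ (s - 2) = a ^ s := by
  rw [← Real.rpow_natCast, ← Real.rpow_add_of_nonneg ha (by norm_num) (by linarith)]
  congr 1
  push_cast
  ring

/-- Hölder's inequality with exponents `s / 2` and `s / (s - 2)`. -/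
lemma sum_mul_sq_mul_rpow_le (hw : ∀ x, 0 ≤ w x) (hu : ∀ x, 0 ≤ u x) (hv : ∀ x, 0 ≤ v x)
    (hs : 2 ≤ s) (hpos : 0 < ∑ x, w x * u x ^ s) :
    ∑ x, w x * (v x ^ 2 * u x ^ (s - 2)) ≤
      (∑ x, w x * v x ^ s) ^ (2 / s) * (∑ x, w x * u x ^ s) ^ (1 - 2 / s) := by
  set a := ∑ x, w x * v x ^ s with ha
  set b := ∑ x, w x * u x ^ s with hb
  have hs0 : 0 < s := by linarith
  have hterm : ∀ x, 0 ≤ w x * v x ^ s := fun x => mul_nonneg (hw x) (Real.rpow_nonneg (hv x) _)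
  have ha' : 0 ≤ a := Finset.sum_nonneg fun x _ => hterm x
  rcases ha'.eq_or_lt with ha0 | ha0
  · have hz : ∀ x, w x * v x ^ s = 0 := fun x =>
      (Finset.sum_eq_zero_iff_of_nonneg fun x _ => hterm x).1 (ha.symm.trans ha0.symm) x
        (Finset.mem_univ x)
    rw [← ha0, Real.zero_rpow (by positivity), zero_mul]
    refine (Finset.sum_eq_zero fun x _ => ?_).le
    rcases mul_eq_zero.1 (hz x) with h | h
    · simp [h]
    · simp [(Real.rpow_eq_zero (hv x) hs0.ne').1 h]
  have h2s : 2 / s ≤ 1 := (div_le_one hs0).2 hs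
  have hD : 0 < a ^ (2 / s) * b ^ (1 - 2 / s) := by positivity
  have hy : ∀ x, v x ^ 2 * u x ^ (s - 2) ≤ a ^ (2 / s) * b ^ (1 - 2 / s) *
      (2 / s * (v x ^ s / a) + (1 - 2 / s) * (u x ^ s / b)) := by
    intro x
    have hvs := Real.rpow_nonneg (hv x) s
    have hus := Real.rpow_nonneg (hu x) s
    have h := Real.geom_mean_le_arith_mean2_weighted (w₁ := 2 / s) (w₂ := 1 - 2 / s)
      (p₁ := v x ^ s / a) (p₂ := u x ^ s / b) (by positivity) (by linarith) (by positivity)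
      (by positivity) (by ring)
    rw [Real.div_rpow hvs ha0.le, Real.div_rpow hus hpos.le, ← Real.rpow_mul (hv x),
      ← Real.rpow_mul (hu x), show s * (2 / s) = ((2 : ℕ) : ℝ) by field_simp; norm_num,
      Real.rpow_natCast, show s * (1 - 2 / s) = s - 2 by field_simp, div_mul_div_comm,
      div_le_iff₀ hD] at h
    linarith
  calc ∑ x, w x * (v x ^ 2 * u x ^ (s - 2))
      ≤ ∑ x, w x * (a ^ (2 / s) * b ^ (1 - 2 / s) *
          (2 / s * (v x ^ s / a) + (1 - 2 / s) * (u x ^ s / b))) :=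
        Finset.sum_le_sum fun x _ => mul_le_mul_of_nonneg_left (hy x) (hw x)
    _ = ∑ x, (a ^ (2 / s) * b ^ (1 - 2 / s) * (2 / s) / a * (w x * v x ^ s) +
          a ^ (2 / s) * b ^ (1 - 2 / s) * (1 - 2 / s) / b * (w x * u x ^ s)) :=
        Finset.sum_congr rfl fun x _ => by ring
    _ = _ := by
        rw [Finset.sum_add_distrib, ← Finset.mul_sum, ← Finset.mul_sum, ← ha, ← hb]
        field_simp
        ring

/-- Power means are monotone in the exponent. -/
lemma rpow_mean_mono (hw : ∀ x, 0 ≤ w x) (hw1 : ∑ x, w x = 1) (hv : ∀ x, 0 ≤ v x)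
    (hs : 0 < s) (hsr : s ≤ r) :
    (∑ x, w x * v x ^ s) ^ (2 / s) ≤ (∑ x, w x * v x ^ r) ^ (2 / r) := by
  have hr : 0 < r := hs.trans_le hsr
  have h := Real.rpow_arith_mean_le_arith_mean_rpow Finset.univ w (fun x => v x ^ s)
    (fun x _ => hw x) hw1 (fun x _ => Real.rpow_nonneg (hv x) _)
    (p := r / s) ((one_le_div hs).2 hsr)
  have h0 : 0 ≤ ∑ x, w x * v x ^ s :=
    Finset.sum_nonneg fun x _ => mul_nonneg (hw x) (Real.rpow_nonneg (hv x) _)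
  have e : ∀ x, (v x ^ s) ^ (r / s) = v x ^ r := fun x => by
    rw [← Real.rpow_mul (hv x)]
    congr 1
    field_simp
  simp only [e] at h
  have h' := Real.rpow_le_rpow (Real.rpow_nonneg h0 _) h (by positivity : 0 ≤ 2 / r)
  rw [← Real.rpow_mul h0] at h'
  convert h' using 2
  field_simp

lemma hasDerivAt_const_rpow_of_nonneg {a : ℝ} (ha : 0 ≤ a) (hs : 0 < s) :
    HasDerivAt (fun t : ℝ => a ^ t) (a ^ s * Real.log a) s := by
  rcases ha.eq_or_lt with rfl | ha
  · rw [Real.log_zero, mul_zero]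
    refine (hasDerivAt_const s (0 : ℝ)).congr_of_eventuallyEq ?_
    filter_upwards [lt_mem_nhds hs] with t ht
    exact Real.zero_rpow ht.ne'
  · simpa [mul_comm] using HasDerivAt.const_rpow ha (hasDerivAt_id s)

/-- Derivative in the exponent of the square of the `L^s` norm. -/
lemma hasDerivAt_sq_norm (hu : ∀ x, 0 ≤ u x) (hs : 0 < s) (hpos : 0 < ∑ x, w x * u x ^ s) :
    HasDerivAt (fun t : ℝ => (∑ x, w x * u x ^ t) ^ (2 / t))
      (2 / s ^ 2 * (∑ x, w x * u x ^ s) ^ (2 / s - 1) *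
        (∑ x, w x * (u x ^ s * Real.log (u x ^ s)) -
          (∑ x, w x * u x ^ s) * Real.log (∑ x, w x * u x ^ s))) s := by
  have h1 : HasDerivAt (fun t : ℝ => ∑ x, w x * u x ^ t)
      (∑ x, w x * (u x ^ s * Real.log (u x))) s :=
    HasDerivAt.fun_sum fun x _ => (hasDerivAt_const_rpow_of_nonneg (hu x) hs).const_mul _
  have h2 : HasDerivAt (fun t : ℝ => 2 / t) (-2 / s ^ 2) s := by
    simpa using (hasDerivAt_const s (2 : ℝ)).fun_div (hasDerivAt_id' s) hs.ne'
  have h := h1.rpow h2 hpos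
  have e : ∑ x, w x * (u x ^ s * Real.log (u x ^ s)) =
      s * ∑ x, w x * (u x ^ s * Real.log (u x)) := by
    rw [Finset.mul_sum]
    refine Finset.sum_congr rfl fun x _ => ?_
    rcases (hu x).eq_or_lt with hx | hx
    · simp [← hx, Real.zero_rpow hs.ne']
    · rw [Real.log_rpow hx]
      ring
  convert h using 1
  rw [e, Real.rpow_sub_one hpos.ne']
  field_simp
  ring

end Moments

namespace ResamplingSystem

variable {Ω ι : Type*} {Y : ι → Type*} [Fintype Ω] [Fintype ι] [∀ i, Fintype (Y i)]
  {S : ResamplingSystem Ω ι Y} {C : ℝ} {f : Ω → ℝ} {h : ι → Ω → ℝ}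

lemma sum_sum_osc_mul_eq (hf : S.IsOscBound f h) (φ : Ω → ℝ) :
    ∑ x, S.w x * ∑ i, h i x ^ 2 * ∑ y, S.cond i x y * φ (S.move i x y) =
      ∑ x, S.w x * (Real.sqrt (∑ i, h i x ^ 2) ^ 2 * φ x) := by
  calc _ = ∑ i, ∑ x, S.w x * ∑ y, S.cond i x y *
        (h i (S.move i x y) ^ 2 * φ (S.move i x y)) := by
        rw [Finset.sum_comm]
        refine Finset.sum_congr rfl fun x _ => ?_
        rw [Finset.mul_sum]
        refine Finset.sum_congr rfl fun i _ => ?_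
        rw [Finset.mul_sum]
        congr 1
        refine Finset.sum_congr rfl fun y _ => ?_
        rw [hf.move_eq]
        ring
    _ = ∑ i, ∑ x, S.w x * (h i x ^ 2 * φ x) :=
        Finset.sum_congr rfl fun i _ => S.invariant i fun x => h i x ^ 2 * φ x
    _ = _ := by
        rw [Finset.sum_comm]
        refine Finset.sum_congr rfl fun x _ => ?_
        rw [Real.sq_sqrt (Finset.sum_nonneg fun i _ => sq_nonneg _), Finset.sum_mul,
          Finset.mul_sum]

lemma energy_le_of_osc (hf : S.IsOscBound f h) :
    S.energy f ≤ (∑ x, S.w x * Real.sqrt (∑ i, h i x ^ 2) ^ 2) / 4 := by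
  rw [Finset.sum_div]
  simp_rw [mul_div_assoc]
  refine sum_le_sum_of_pos fun x hx => ?_
  rw [Real.sq_sqrt (Finset.sum_nonneg fun i _ => sq_nonneg _), Finset.sum_div]
  exact Finset.sum_le_sum fun i _ => sum_mul_sq_sub_mean_le_of_osc (S.cond_nonneg i x)
    (S.cond_sum i x hx) (hf.osc i x)

/-- Energy of `u ^ (s / 2)`, as long as the `L^s` norm of `u` is at least half the one of its
oscillation. -/
lemma energy_rpow_le {u : Ω → ℝ} (hu : ∀ x, 0 ≤ u x) (huh : S.IsOscBound u h)
    (h0 : ∀ i x, 0 ≤ h i x) {s : ℝ} (hs : 2 ≤ s) (hpos : 0 < ∑ x, S.w x * u x ^ s)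
    (hhalf : (1 / 2) ^ s * ∑ x, S.w x * Real.sqrt (∑ i, h i x ^ 2) ^ s ≤
      ∑ x, S.w x * u x ^ s) :
    S.energy (fun x => u x ^ (s / 2)) ≤ s ^ 2 / 8 *
      ((∑ x, S.w x * Real.sqrt (∑ i, h i x ^ 2) ^ s) ^ (2 / s) *
        (∑ x, S.w x * u x ^ s) ^ (1 - 2 / s)) := by
  set V : Ω → ℝ := fun x => Real.sqrt (∑ i, h i x ^ 2) with hV
  have hV0 : ∀ x, 0 ≤ V x := fun x => Real.sqrt_nonneg _
  have hVsq : ∀ x, V x ^ 2 = ∑ i, h i x ^ 2 := fun x =>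
    Real.sq_sqrt (Finset.sum_nonneg fun i _ => sq_nonneg _)
  have hH := sum_mul_sq_mul_rpow_le S.w_nonneg hu hV0 hs hpos
  have hE := sum_sum_osc_mul_eq huh fun x => u x ^ (s - 2)
  set a := ∑ x, S.w x * V x ^ s with ha
  set b := ∑ x, S.w x * u x ^ s with hb
  set E := ∑ x, S.w x * (V x ^ 2 * u x ^ (s - 2)) with hEdef
  have hs0 : 0 < s := by linarith
  have ha0 : 0 ≤ a :=
    Finset.sum_nonneg fun x _ => mul_nonneg (S.w_nonneg x) (Real.rpow_nonneg (hV0 x) _)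
  rcases le_total 3 s with h3 | h3
  · refine le_trans ?_ (mul_le_mul_of_nonneg_left hH (by positivity))
    rw [← hE, Finset.mul_sum]
    simp_rw [mul_left_comm (s ^ 2 / 8)]
    refine sum_le_sum_of_pos fun x hx => ?_
    rw [Finset.mul_sum]
    exact Finset.sum_le_sum fun i _ => variance_rpow_le_of_three_le (S.cond_nonneg i x)
      (S.cond_sum i x hx) (fun y => hu (S.move i x y)) (huh.osc i x) h3
  · have hsmall : (1 / 2) ^ (s - 2) * a ≤ a ^ (2 / s) * b ^ (1 - 2 / s) := by
      rcases ha0.eq_or_lt with h | h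
      · rw [← h, mul_zero]
        positivity
      have h2s : 2 / s ≤ 1 := (div_le_one hs0).2 hs
      have h1 := Real.rpow_le_rpow (by positivity) hhalf (by linarith : 0 ≤ 1 - 2 / s)
      rw [Real.mul_rpow (by positivity) ha0, ← Real.rpow_mul (by norm_num),
        show s * (1 - 2 / s) = s - 2 by field_simp] at h1
      calc (1 / 2) ^ (s - 2) * a
          = a ^ (2 / s) * ((1 / 2) ^ (s - 2) * a ^ (1 - 2 / s)) := by
            rw [mul_left_comm, ← Real.rpow_add h]
            simp
        _ ≤ _ := by gcongr
    have hbound : S.energy (fun x => u x ^ (s / 2)) ≤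
        s ^ 2 / 16 * (E + (1 / 2) ^ (s - 2) * a) := by
      rw [← hE, ha, Finset.mul_sum, ← Finset.sum_add_distrib, Finset.mul_sum]
      simp_rw [mul_left_comm ((1 / 2 : ℝ) ^ (s - 2)), ← mul_add, mul_left_comm (s ^ 2 / 16)]
      refine sum_le_sum_of_pos fun x hx => ?_
      rw [← sq_mul_rpow_sub_two (hV0 x) hs, hVsq, Finset.sum_mul, Finset.mul_sum,
        ← Finset.sum_add_distrib, Finset.mul_sum]
      refine Finset.sum_le_sum fun i _ => ?_
      refine (variance_rpow_le_of_le_three (S.cond_nonneg i x)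
        (S.cond_sum i x hx) (fun y => hu (S.move i x y)) (huh.osc i x) hs h3).trans ?_
      have hhV : h i x ≤ V x := Real.le_sqrt_of_sq_le
        (Finset.single_le_sum (f := fun i => h i x ^ 2) (fun i _ => sq_nonneg _)
          (Finset.mem_univ i))
      have hpow : (h i x / 2) ^ (s - 2) ≤ (1 / 2) ^ (s - 2) * V x ^ (s - 2) := by
        rw [← Real.mul_rpow (by norm_num) (hV0 x)]
        exact Real.rpow_le_rpow (by linarith [h0 i x]) (by linarith) (by linarith)
      have := mul_le_mul_of_nonneg_left hpow (sq_nonneg (h i x))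
      refine mul_le_mul_of_nonneg_left ?_ (by positivity)
      linarith
    calc _ ≤ _ := hbound
      _ ≤ s ^ 2 / 16 * (a ^ (2 / s) * b ^ (1 - 2 / s) + a ^ (2 / s) * b ^ (1 - 2 / s)) := by
          gcongr
      _ = _ := by ring

end ResamplingSystem

namespace ResamplingSystem

variable {Ω ι : Type*} {Y : ι → Type*} [Fintype Ω] [Fintype ι] [∀ i, Fintype (Y i)]
  {S : ResamplingSystem Ω ι Y} {C : ℝ} {g : Ω → ℝ} {h : ι → Ω → ℝ}

lemma IsOscBound.abs (hf : S.IsOscBound g h) : S.IsOscBound (fun x => |g x|) h where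
  osc i x y z hy hz := (abs_abs_sub_abs_le_abs_sub _ _).trans (hf.osc i x y z hy hz)
  move_eq := hf.move_eq

/-- Entropy of `u ^ s` under a logarithmic Sobolev inequality. -/
lemma LogSobolev.entropy_rpow_le (hS : S.LogSobolev C) {u : Ω → ℝ} (hu : ∀ x, 0 ≤ u x) (s : ℝ) :
    ∑ x, S.w x * (u x ^ s * Real.log (u x ^ s)) -
      (∑ x, S.w x * u x ^ s) * Real.log (∑ x, S.w x * u x ^ s) ≤
      2 * C * S.energy fun x => u x ^ (s / 2) := by
  have h := hS fun x => u x ^ (s / 2)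
  have e : ∀ x, (u x ^ (s / 2)) ^ 2 = u x ^ s := fun x => by
    rw [← Real.rpow_natCast, ← Real.rpow_mul (hu x)]
    congr 1
    push_cast
    ring
  simpa only [e] using h

/-- Moment bound for centred functions under a logarithmic Sobolev inequality. -/
theorem LogSobolev.sq_norm_le (hS : S.LogSobolev C) (hC : 1 ≤ C)
    (hg : ∑ x, S.w x * g x = 0) (hgh : S.IsOscBound g h) (h0 : ∀ i x, 0 ≤ h i x)
    {r : ℝ} (hr : 2 ≤ r) :
    (∑ x, S.w x * |g x| ^ r) ^ (2 / r) ≤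
      C * (r - 3 / 2) / 2 * (∑ x, S.w x * Real.sqrt (∑ i, h i x ^ 2) ^ r) ^ (2 / r) := by
  set V : Ω → ℝ := fun x => Real.sqrt (∑ i, h i x ^ 2) with hV
  have hV0 : ∀ x, 0 ≤ V x := fun x => Real.sqrt_nonneg _
  have hu : ∀ x, 0 ≤ |g x| := fun x => abs_nonneg _
  have hsum0 : ∀ (v : Ω → ℝ), (∀ x, 0 ≤ v x) → ∀ s : ℝ, 0 ≤ ∑ x, S.w x * v x ^ s :=
    fun v hv s => Finset.sum_nonneg fun x _ =>
      mul_nonneg (S.w_nonneg x) (Real.rpow_nonneg (hv x) _)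
  set A := (∑ x, S.w x * V x ^ r) ^ (2 / r) with hA
  have hA0 : 0 ≤ A := Real.rpow_nonneg (hsum0 V hV0 r) _
  rcases (hsum0 _ hu r).eq_or_lt with hz | hz
  · rw [← hz, Real.zero_rpow (by positivity)]
    have : 0 ≤ r - 3 / 2 := by linarith
    positivity
  obtain ⟨x₀, -, hx₀⟩ := Finset.exists_ne_zero_of_sum_ne_zero hz.ne'
  have hpos : ∀ s : ℝ, 0 < ∑ x, S.w x * |g x| ^ s := by
    intro s
    have hw : 0 < S.w x₀ := (S.w_nonneg x₀).lt_of_ne' (left_ne_zero_of_mul hx₀)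
    have hg0 : 0 < |g x₀| := (hu x₀).lt_of_ne' fun h => right_ne_zero_of_mul hx₀ (by
      rw [h, Real.zero_rpow (by linarith)])
    exact (mul_pos hw (Real.rpow_pos_of_pos hg0 s)).trans_le
      (Finset.single_le_sum (f := fun x => S.w x * |g x| ^ s)
        (fun x _ => mul_nonneg (S.w_nonneg x) (Real.rpow_nonneg (hu x) _)) (Finset.mem_univ x₀))
  have hmono : ∀ s : ℝ, 2 ≤ s → s ≤ r → (∑ x, S.w x * V x ^ s) ^ (2 / s) ≤ A := fun s hs hsr =>
    rpow_mean_mono S.w_nonneg S.w_sum hV0 (by linarith) hsr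
  have hder := fun (s : ℝ) (hs : 2 ≤ s) =>
    hasDerivAt_sq_norm (w := S.w) hu (by linarith : 0 < s) (hpos s)
  have hstart : (∑ x, S.w x * |g x| ^ (2 : ℝ)) ^ (2 / (2 : ℝ)) ≤ C * (1 / 4) * A := by
    have h2 := hmono 2 le_rfl hr
    norm_num at h2 ⊢
    have h3 := energy_le_of_osc hgh
    have h4 := hS.poincare_of_mean_zero hg
    have h5 : S.energy g ≤ A / 4 := by linarith
    nlinarith [mul_le_mul_of_nonneg_left h5 (by linarith : 0 ≤ C)]
  have hfinal : ∀ ε : ℝ, 0 < ε → (∑ x, S.w x * |g x| ^ r) ^ (2 / r) ≤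
      C * (r - 3 / 2) / 2 * A + ε * (r - 2) := by
    intro ε hε
    refine image_le_of_deriv_right_lt_deriv_boundary (a := 2) (b := r)
      (f := fun s => (∑ x, S.w x * |g x| ^ s) ^ (2 / s))
      (B := fun s => C * (s - 3 / 2) / 2 * A + ε * (s - 2)) (B' := fun _ => C / 2 * A + ε)
      (fun s hs => (hder s hs.1).continuousAt.continuousWithinAt)
      (fun s hs => (hder s hs.1).hasDerivWithinAt) ?_ ?_ ?_ ⟨hr, le_rfl⟩
    · refine hstart.trans_eq ?_
      ring
    · intro s
      have h1 := ((((hasDerivAt_id' s).sub_const (3 / 2)).const_mul C).div_const 2).mul_const A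
      have h2 := ((hasDerivAt_id' s).sub_const 2).const_mul ε
      simpa using h1.fun_add h2
    · intro s hs heq
      have hs0 : 0 < s := by linarith [hs.1]
      have hAs := hmono s hs.1 hs.2.le
      have hb := hpos s
      have ha := hsum0 V hV0 s
      have hent := hS.entropy_rpow_le hu s
      have hen := energy_rpow_le hu hgh.abs h0 hs.1 hb
      change _ → _ ≤ s ^ 2 / 8 * ((∑ x, S.w x * V x ^ s) ^ (2 / s) * _) at hen
      set a := ∑ x, S.w x * V x ^ s with ha_def
      set b := ∑ x, S.w x * |g x| ^ s with hb_def
      have hquarter : 1 / 4 * a ^ (2 / s) ≤ b ^ (2 / s) := by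
        rw [heq]
        have h1 : 1 / 4 ≤ C * (s - 3 / 2) / 2 := by nlinarith [hs.1]
        have h2 : 0 ≤ ε * (s - 2) := mul_nonneg hε.le (by linarith [hs.1])
        calc 1 / 4 * a ^ (2 / s) ≤ C * (s - 3 / 2) / 2 * A := by gcongr
          _ ≤ _ := by linarith
      have hhalf : (1 / 2) ^ s * a ≤ b := by
        have h1 := Real.rpow_le_rpow (by positivity) hquarter (by positivity : 0 ≤ s / 2)
        rw [Real.mul_rpow (by norm_num) (by positivity), ← Real.rpow_mul ha,
          ← Real.rpow_mul hb.le, show 2 / s * (s / 2) = 1 by field_simp, Real.rpow_one,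
          Real.rpow_one] at h1
        have h2 : (1 / 4 : ℝ) ^ (s / 2) = (1 / 2) ^ s := by
          rw [show (1 / 4 : ℝ) = (1 / 2) ^ (2 : ℝ) by norm_num, ← Real.rpow_mul (by norm_num)]
          congr 1
          ring
        rwa [h2] at h1
      have hmain := hent.trans (mul_le_mul_of_nonneg_left (hen hhalf) (by linarith : 0 ≤ 2 * C))
      have hcoef : 0 ≤ 2 / s ^ 2 * b ^ (2 / s - 1) := by positivity
      have hbb : b ^ (2 / s - 1) * b ^ (1 - 2 / s) = 1 := by
        rw [← Real.rpow_add hb]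
        simp
      calc _ ≤ 2 / s ^ 2 * b ^ (2 / s - 1) *
            (2 * C * (s ^ 2 / 8 * (a ^ (2 / s) * b ^ (1 - 2 / s)))) :=
            mul_le_mul_of_nonneg_left hmain hcoef
        _ = C / 2 * a ^ (2 / s) * (b ^ (2 / s - 1) * b ^ (1 - 2 / s)) := by
            field_simp
            ring
        _ = C / 2 * a ^ (2 / s) := by rw [hbb, mul_one]
        _ ≤ C / 2 * A := by gcongr
        _ < _ := by linarith
  have hlim : Filter.Tendsto (fun ε : ℝ => C * (r - 3 / 2) / 2 * A + ε * (r - 2))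
      (nhdsWithin 0 (Set.Ioi 0)) (nhds (C * (r - 3 / 2) / 2 * A)) := by
    have : Continuous fun ε : ℝ => C * (r - 3 / 2) / 2 * A + ε * (r - 2) := by fun_prop
    simpa using (this.tendsto 0).mono_left nhdsWithin_le_nhds
  exact ge_of_tendsto hlim (by filter_upwards [self_mem_nhdsWithin] with ε hε; exact hfinal ε hε)

end ResamplingSystem

/-- The system on a product of finite sets which resamples one coordinate given the others. -/
def ResamplingSystem.ofWeights {ι : Type*} [Fintype ι] [DecidableEq ι] {𝒳 : ι → Type*}
    [∀ i, Fintype (𝒳 i)] (p : (∀ i, 𝒳 i) → ℝ) (hp : ∀ x, 0 ≤ p x) (hp1 : ∑ x, p x = 1)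
    (cond : ∀ i, (∀ i, 𝒳 i) → 𝒳 i → ℝ)
    (hcond : ∀ i x y, cond i x y =
      p (Function.update x i y) / ∑ z, p (Function.update x i z)) :
    ResamplingSystem (∀ i, 𝒳 i) ι 𝒳 where
  w := p
  cond := cond
  move i x y := Function.update x i y
  w_nonneg := hp
  w_sum := hp1
  cond_nonneg i x y := by
    rw [hcond]
    exact div_nonneg (hp _) (Finset.sum_nonneg fun _ _ => hp _)
  cond_sum i x hx := by
    have hpos : 0 < ∑ z, p (Function.update x i z) :=
      Finset.sum_pos' (fun _ _ => hp _) ⟨x i, Finset.mem_univ _, by simpa using hx⟩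
    simp_rw [hcond, ← Finset.sum_div]
    exact div_self hpos.ne'
  invariant i φ := by
    have hinv : Function.Involutive fun a : (∀ i, 𝒳 i) × 𝒳 i =>
        (Function.update a.1 i a.2, a.1 i) := fun a => by simp
    calc ∑ x, p x * ∑ y, cond i x y * φ (Function.update x i y)
        = ∑ a : (∀ i, 𝒳 i) × 𝒳 i,
            p a.1 * (cond i a.1 a.2 * φ (Function.update a.1 i a.2)) := by
          rw [Fintype.sum_prod_type]
          simp_rw [Finset.mul_sum]
      _ = ∑ a : (∀ i, 𝒳 i) × 𝒳 i, p (Function.update a.1 i a.2) *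
            (p a.1 / (∑ z, p (Function.update a.1 i z)) * φ a.1) := by
          rw [← Equiv.sum_comp hinv.toPerm]
          refine Finset.sum_congr rfl fun a _ => ?_
          simp [hcond]
      _ = ∑ x, p x * φ x := by
          rw [Fintype.sum_prod_type]
          refine Finset.sum_congr rfl fun x _ => ?_
          change ∑ y, p (Function.update x i y) *
            (p x / (∑ z, p (Function.update x i z)) * φ x) = p x * φ x
          rw [← Finset.sum_mul]
          rcases (hp x).eq_or_lt with hx | hx
          · simp [← hx]
          have hpos : 0 < ∑ z, p (Function.update x i z) :=
            Finset.sum_pos' (fun _ _ => hp _) ⟨x i, Finset.mem_univ _, by simpa using hx⟩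
          field_simp

/-- On a product space the logarithmic Sobolev constant is at least `1`, unless the measure is a
Dirac mass. -/
lemma ResamplingSystem.LogSobolev.one_le_or_eq {ι : Type*} [Fintype ι] [DecidableEq ι]
    {𝒳 : ι → Type*} [∀ i, Fintype (𝒳 i)] {S : ResamplingSystem (∀ i, 𝒳 i) ι 𝒳} {C : ℝ}
    (hS : S.LogSobolev C) (hmove : ∀ i x y, S.move i x y = Function.update x i y) :
    1 ≤ C ∨ ∀ x x', 0 < S.w x → 0 < S.w x' → x = x' := by
  classical
  by_cases hC : 1 ≤ C
  · exact Or.inl hC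
  refine Or.inr fun x x' hx hx' => funext fun j => ?_
  by_contra hne
  refine hC (hS.one_le (f := fun z => if z j = x j then 1 else 0) (j := j) ?_ ?_)
  · intro i hij z y
    rw [hmove, Function.update_of_ne hij.symm]
  · set f : (∀ i, 𝒳 i) → ℝ := fun z => if z j = x j then 1 else 0 with hf
    rw [← sum_mul_sq_sub_mean S.w_sum]
    set m := ∑ z, S.w z * f z
    have hterm : ∀ z, 0 ≤ S.w z * (f z - m) ^ 2 := fun z =>
      mul_nonneg (S.w_nonneg z) (sq_nonneg _)
    have h1 : f x = 1 := by simp [hf]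
    have h0 : f x' = 0 := by simp [hf, Ne.symm hne]
    by_cases hm : m = 0
    · refine Finset.sum_pos' (fun z _ => hterm z) ⟨x, Finset.mem_univ _, ?_⟩
      change 0 < S.w x * (f x - m) ^ 2
      rw [h1, hm]
      simpa using hx
    · refine Finset.sum_pos' (fun z _ => hterm z) ⟨x', Finset.mem_univ _, ?_⟩
      change 0 < S.w x' * (f x' - m) ^ 2
      rw [h0, zero_sub, neg_sq]
      positivity

/-- Moment bound under a `𝔡`-log-Sobolev inequality on a product of finite sets. -/
theorem stmt_19 {n : ℕ} {𝒳 : Fin n → Type*} [∀ i, Fintype (𝒳 i)]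
    [∀ i, MeasurableSpace (𝒳 i)] [∀ i, MeasurableSingletonClass (𝒳 i)]
    (μ : Measure (∀ i, 𝒳 i)) [IsProbabilityMeasure μ] (σ : ℝ) (hσ : 0 < σ)
    (cond : ∀ i : Fin n, (∀ i, 𝒳 i) → 𝒳 i → ℝ)
    (hcond : ∀ i x y, cond i x y =
      (μ {z | z = Function.update x i y}).toReal /
        ∑ y' : 𝒳 i, (μ {z | z = Function.update x i y'}).toReal)
    (hLSI : ∀ f : (∀ i, 𝒳 i) → ℝ,
      ∫ x, (f x) ^ 2 * Real.log ((f x) ^ 2) ∂μ -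
        (∫ x, (f x) ^ 2 ∂μ) * Real.log (∫ x, (f x) ^ 2 ∂μ) ≤
        2 * σ ^ 2 * ∫ x, ∑ i, ∑ y : 𝒳 i, cond i x y *
          (f (Function.update x i y) -
            ∑ y' : 𝒳 i, cond i x y' * f (Function.update x i y')) ^ 2 ∂μ) :
    ∀ f : (∀ i, 𝒳 i) → ℝ, (∃ M, ∀ x, |f x| ≤ M) → ∀ r : ℝ, 2 ≤ r →
      (∫ x, |f x - ∫ y, f y ∂μ| ^ r ∂μ) ^ (1 / r) ≤
        Real.sqrt (σ ^ 2 * (r - 3 / 2) / 2) *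
          (∫ x, (Real.sqrt (∑ i,
            (⨆ y : {y : 𝒳 i // 0 < cond i x y}, ⨆ y' : {y' : 𝒳 i // 0 < cond i x y'},
              |f (Function.update x i y.1) - f (Function.update x i y'.1)|) ^ 2)) ^ r ∂μ)
            ^ (1 / r) := by
  intro f _ r hr
  have hint : ∀ F : (∀ i, 𝒳 i) → ℝ, ∫ x, F x ∂μ = ∑ x, μ.real {x} * F x := fun F => by
    simpa using integral_fintype (μ := μ) (f := F) Integrable.of_finite
  have hp1 : ∑ x, μ.real {x} = 1 := by simp
  let S := ResamplingSystem.ofWeights (fun x => μ.real {x}) (fun x => measureReal_nonneg) hp1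
    cond hcond
  have hS : S.LogSobolev (σ ^ 2) := fun g => by
    have h := hLSI g
    simp only [hint] at h
    exact h
  have hr0 : 0 < r := by linarith
  simp only [hint]
  set m := ∑ x, μ.real {x} * f x with hm
  rcases hS.one_le_or_eq (fun _ _ _ => rfl) with hσ1 | hdirac
  swap
  · have hz : ∑ x, μ.real {x} * |f x - m| ^ r = 0 := by
      refine Finset.sum_eq_zero fun x _ => ?_
      rcases (measureReal_nonneg (μ := μ) (s := {x})).eq_or_lt with hx | hx
      · simp [← hx]
      · have hmx : m = f x := by
          calc m = ∑ z, S.w z * f x :=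
                ResamplingSystem.sum_eq_sum_of_pos (S := S) fun z hz => by rw [hdirac z x hz hx]
            _ = f x := by rw [← Finset.sum_mul, S.w_sum, one_mul]
        simp [hmx, Real.zero_rpow hr0.ne']
    rw [hz, Real.zero_rpow (by positivity)]
    refine mul_nonneg (Real.sqrt_nonneg _) (Real.rpow_nonneg (Finset.sum_nonneg fun x _ => ?_) _)
    exact mul_nonneg measureReal_nonneg (Real.rpow_nonneg (Real.sqrt_nonneg _) _)
  set h : Fin n → (∀ i, 𝒳 i) → ℝ := fun i x =>
    ⨆ y : {y : 𝒳 i // 0 < cond i x y}, ⨆ y' : {y' : 𝒳 i // 0 < cond i x y'},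
      |f (Function.update x i y.1) - f (Function.update x i y'.1)| with hh
  have h0 : ∀ i x, 0 ≤ h i x := fun i x =>
    Real.iSup_nonneg fun y => Real.iSup_nonneg fun y' => abs_nonneg _
  have hosc : S.IsOscBound (fun x => f x - m) h := by
    refine ⟨fun i x y z hy hz => ?_, fun i x y => ?_⟩
    · rw [sub_sub_sub_cancel_right]
      exact (le_ciSup (f := fun y' : {y' : 𝒳 i // 0 < cond i x y'} =>
          |f (Function.update x i y) - f (Function.update x i y'.1)|)
          (Set.finite_range _).bddAbove ⟨z, hz⟩).trans
        (le_ciSup (f := fun y : {y : 𝒳 i // 0 < cond i x y} =>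
          ⨆ y' : {y' : 𝒳 i // 0 < cond i x y'},
            |f (Function.update x i y.1) - f (Function.update x i y'.1)|)
          (Set.finite_range _).bddAbove ⟨y, hy⟩)
    · have hc : cond i (Function.update x i y) = cond i x := by
        funext z
        simp [hcond]
      change h i (Function.update x i y) = h i x
      simp only [hh, Function.update_idem]
      rw [hc]
  have hmean : ∑ x, S.w x * (f x - m) = 0 := by
    simp_rw [mul_sub]
    rw [Finset.sum_sub_distrib, ← Finset.sum_mul, S.w_sum, one_mul]
    exact sub_self m
  have hmain := hS.sq_norm_le hσ1 hmean hosc h0 hr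
  change (∑ x, μ.real {x} * |f x - m| ^ r) ^ (2 / r) ≤
    σ ^ 2 * (r - 3 / 2) / 2 * (∑ x, μ.real {x} * Real.sqrt (∑ i, h i x ^ 2) ^ r) ^ (2 / r)
    at hmain
  have ha : 0 ≤ ∑ x, μ.real {x} * |f x - m| ^ r := Finset.sum_nonneg fun x _ =>
    mul_nonneg measureReal_nonneg (Real.rpow_nonneg (abs_nonneg _) _)
  have hb : 0 ≤ ∑ x, μ.real {x} * Real.sqrt (∑ i, h i x ^ 2) ^ r := Finset.sum_nonneg fun x _ =>
    mul_nonneg measureReal_nonneg (Real.rpow_nonneg (Real.sqrt_nonneg _) _)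
  have hsq : ∀ {a : ℝ}, 0 ≤ a → (a ^ (1 / r)) ^ 2 = a ^ (2 / r) := fun {a} ha => by
    rw [← Real.rpow_natCast, ← Real.rpow_mul ha]
    congr 1
    push_cast
    ring
  refine (sq_le_sq₀ (Real.rpow_nonneg ha _)
    (mul_nonneg (Real.sqrt_nonneg _) (Real.rpow_nonneg hb _))).1 ?_
  rw [mul_pow, hsq ha, hsq hb, Real.sq_sqrt]
  · exact hmain
  · have : 0 ≤ r - 3 / 2 := by linarith
    positivity
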